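/- Let M be an R-module projective in σ[M] and a semiprime module. Then for every submodule N of M, Ann_M(N) = Ann_M^r(N), where Ann_M^r(N) = Σ { L ⊆ M : N_M L = 0 } is the right annihilator of N in M. -/

import Mathlib

/- Common definitions: the category σ[M], projectivity in σ[M], the product
   K_M L of submodules, annihilators, prime/semiprime submodules, hereditary
   torsion theories, M-singular modules, etc., following the paper. -/

universe u v

section Defs

variable (R : Type u) [Ring R]

/-- `N` belongs to `σ[M]`: `N` is isomorphic to a submodule of an `M`-generated
module, i.e. `N` embeds into a quotient of a direct sum of copies of `M`. -/
def InSigma (M : Type v) [AddCommGroup M] [Module R M]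
    (N : Type v) [AddCommGroup N] [Module R N] : Prop :=
  ∃ (ι : Type v) (K : Submodule R (ι →₀ M)) (g : N →ₗ[R] ((ι →₀ M) ⧸ K)),
    Function.Injective g

/-- `M` is projective in `σ[M]`. -/
def ProjInSigma (M : Type v) [AddCommGroup M] [Module R M] : Prop :=
  ∀ (A B : Type v) [AddCommGroup A] [Module R A] [AddCommGroup B] [Module R B],
    InSigma R M A → InSigma R M B →
      ∀ (p : A →ₗ[R] B), Function.Surjective p →
        ∀ f : M →ₗ[R] B, ∃ g : M →ₗ[R] A, p.comp g = f

variable (M : Type v) [AddCommGroup M] [Module R M]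

/-- The product `K_M L = Σ { f(K) : f ∈ Hom_R(M, L) }` of submodules of `M`. -/
def prodM (K L : Submodule R M) : Submodule R M :=
  ⨆ f ∈ {f : M →ₗ[R] M | LinearMap.range f ≤ L}, Submodule.map f K

/-- `Ann_M(X) = ∩ { ker f : f ∈ Hom_R(M, X) }`. -/
def annM (X : Type v) [AddCommGroup X] [Module R X] : Submodule R M :=
  ⨅ f : M →ₗ[R] X, LinearMap.ker f

/-- The right annihilator `Ann_M^r(N) = Σ { L ⊆ M : N_M L = 0 }`. -/
def annMr (N : Submodule R M) : Submodule R M :=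
  sSup {L : Submodule R M | prodM R M N L = ⊥}

/-- A submodule is fully invariant if it is stable under all endomorphisms. -/
def IsFullyInvariant (N : Submodule R M) : Prop :=
  ∀ f : M →ₗ[R] M, Submodule.map f N ≤ N

/-- `M` is a semiprime module: `K_M K = 0` implies `K = 0`. -/
def IsSemiprime : Prop :=
  ∀ K : Submodule R M, prodM R M K K = ⊥ → K = ⊥

/-- `P` is prime in `M`. -/
def PrimeIn (P : Submodule R M) : Prop :=
  P ≠ ⊤ ∧ IsFullyInvariant R M P ∧
    ∀ K L : Submodule R M, IsFullyInvariant R M K → IsFullyInvariant R M L →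
      prodM R M K L ≤ P → K ≤ P ∨ L ≤ P

/-- `P` is a minimal prime in `M`. -/
def MinPrimeIn (P : Submodule R M) : Prop :=
  PrimeIn R M P ∧ ∀ Q : Submodule R M, PrimeIn R M Q → Q ≤ P → Q = P

/-- Powers of a submodule: `powM N k = N^(k+1)`, i.e. `powM N 0 = N` and
`powM N (k+1) = N_M (powM N k)`. -/
def powM (N : Submodule R M) : ℕ → Submodule R M
  | 0 => N
  | k + 1 => prodM R M N (powM N k)

/-- The set of annihilator submodules `∩_{f ∈ X} ker f` for `X ⊆ End_R(M)`. -/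
def AnnSet : Set (Submodule R M) :=
  {N | ∃ X : Set (M →ₗ[R] M), N = ⨅ f ∈ X, LinearMap.ker f}

/-- `M` satisfies ACC on annihilators. -/
def AccOnAnnihilators : Prop :=
  ∀ c : ℕ → Submodule R M, (∀ n, c n ∈ AnnSet R M) → Monotone c →
    ∃ n, ∀ m, n ≤ m → c m = c n

/-- `U` is a uniform submodule of `M`. -/
def UniformSub (U : Submodule R M) : Prop :=
  U ≠ ⊥ ∧ ∀ A B : Submodule R M, A ≤ U → B ≤ U → A ≠ ⊥ → B ≠ ⊥ → A ⊓ B ≠ ⊥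

end Defs

section Torsion

variable (R : Type u) [Ring R]

/-- A hereditary torsion theory, presented via its torsion class: a class of
modules closed under submodules, quotients, extensions, isomorphisms and
direct sums. -/
structure HTC : Type (max u (v + 1)) where
  torsion : ∀ (N : Type v) [AddCommGroup N] [Module R N], Prop
  closed_sub : ∀ (N : Type v) [AddCommGroup N] [Module R N],
    torsion N → ∀ K : Submodule R N, torsion K
  closed_quot : ∀ (N : Type v) [AddCommGroup N] [Module R N],
    torsion N → ∀ K : Submodule R N, torsion (N ⧸ K)
  closed_ext : ∀ (N : Type v) [AddCommGroup N] [Module R N] (K : Submodule R N),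
    torsion K → torsion (N ⧸ K) → torsion N
  closed_iso : ∀ (N N' : Type v) [AddCommGroup N] [Module R N]
    [AddCommGroup N'] [Module R N'], (N ≃ₗ[R] N') → torsion N → torsion N'
  closed_dsum : ∀ (ι : Type v) (F : ι → Type v) [DecidableEq ι]
    [∀ i, AddCommGroup (F i)] [∀ i, Module R (F i)],
    (∀ i, torsion (F i)) → torsion (DirectSum ι F)

/-- `N` is `τ`-torsion-free. -/
def TorsionFreeFor (τ : HTC.{u, v} R) (N : Type v) [AddCommGroup N] [Module R N] : Prop :=
  ∀ K : Submodule R N, τ.torsion ↥K → K = ⊥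

variable (M : Type v) [AddCommGroup M] [Module R M]

/-- `N` is `χ(M)`-torsion: torsion for some (hence for the greatest) hereditary
torsion theory for which `M` is torsion-free. -/
def ChiTorsion (N : Type v) [AddCommGroup N] [Module R N] : Prop :=
  ∃ τ : HTC.{u, v} R, TorsionFreeFor R τ M ∧ τ.torsion N

/-- `N` is `χ(M)`-torsion-free. -/
def ChiTorsionFree (N : Type v) [AddCommGroup N] [Module R N] : Prop :=
  ∀ K : Submodule R N, ChiTorsion R M ↥K → K = ⊥

/-- `X` is `M`-singular: `X ≅ L/K` with `L ∈ σ[M]` and `K` essential in `L`. -/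
def IsMSingular (X : Type v) [AddCommGroup X] [Module R X] : Prop :=
  ∃ (L : Type v) (iL : AddCommGroup L)
    (mL : @Module R L inferInstance iL.toAddCommMonoid),
    letI := iL
    letI := mL
    InSigma R M L ∧ ∃ K : Submodule R L,
      (∀ K' : Submodule R L, K' ≠ ⊥ → K ⊓ K' ≠ ⊥) ∧ Nonempty (X ≃ₗ[R] (L ⧸ K))

/-- The `M`-singular submodule `Z(M)` of `M`. -/
def singularSub : Submodule R M :=
  sSup {K : Submodule R M | IsMSingular R M ↥K}

/-- `Ass_M(X)`: the set of primes in `M` associated to `X`. -/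
def AssM (X : Type v) [AddCommGroup X] [Module R X] : Set (Submodule R M) :=
  {P | P ≠ ⊤ ∧ IsFullyInvariant R M P ∧
    ∃ L : Submodule R X, L ≠ ⊥ ∧
      ∀ L' : Submodule R X, L' ≠ ⊥ → L' ≤ L → annM R M ↥L' = P}

/-- `E` is an injective object of `σ[M]`. -/
def InjInSigma (E : Type v) [AddCommGroup E] [Module R E] : Prop :=
  InSigma R M E ∧
    ∀ (B : Type v) [AddCommGroup B] [Module R B], InSigma R M B →
      ∀ (A : Submodule R B) (f : ↥A →ₗ[R] E),
        ∃ g : B →ₗ[R] E, ∀ a : A, g ↑a = f a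

/-- `E` is an indecomposable module. -/
def Indecomp (E : Type v) [AddCommGroup E] [Module R E] : Prop :=
  (⊥ : Submodule R E) ≠ ⊤ ∧
    ∀ A B : Submodule R E, IsCompl A B → A = ⊥ ∨ A = ⊤

/-- `M` has finite uniform dimension: there is no infinite independent family
of nonzero submodules. -/
def FiniteUniformDimension : Prop :=
  ¬ ∃ f : ℕ → Submodule R M, (∀ n, f n ≠ ⊥) ∧
      ∀ n : ℕ, f n ⊓ (⨆ m ∈ {m : ℕ | m ≠ n}, f m) = ⊥

/-- `M` is a continuous module (conditions C1 and C2). -/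
def ContinuousModule : Prop :=
  (∀ N : Submodule R M, ∃ D : Submodule R M, (∃ D', IsCompl D D') ∧ N ≤ D ∧
      ∀ L : Submodule R M, L ≤ D → L ≠ ⊥ → N ⊓ L ≠ ⊥) ∧
  (∀ N D : Submodule R M, (∃ D', IsCompl D D') → Nonempty (↥N ≃ₗ[R] ↥D) →
      ∃ N', IsCompl N N')

end Torsion

section ProductOfSubmodules

variable {R : Type u} [Ring R] {M : Type v} [AddCommGroup M] [Module R M]

theorem inSigma_of_injective {ι : Type v} {X : Type v} [AddCommGroup X] [Module R X]
    (f : X →ₗ[R] (ι →₀ M)) (hf : Function.Injective f) : InSigma R M X :=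
  ⟨ι, ⊥, (Submodule.quotEquivOfEqBot ⊥ rfl).symm.toLinearMap ∘ₗ f,
    (Submodule.quotEquivOfEqBot (⊥ : Submodule R (ι →₀ M)) rfl).symm.injective.comp hf⟩

theorem inSigma_submodule (L : Submodule R M) : InSigma R M L :=
  inSigma_of_injective (ι := PUnit) (Finsupp.lsingle PUnit.unit ∘ₗ L.subtype)
    ((Finsupp.single_injective _).comp L.injective_subtype)

theorem inSigma_finsupp_submodule (ι : Type v) (L : Submodule R M) : InSigma R M (ι →₀ L) :=
  inSigma_of_injective (Finsupp.mapRange.linearMap L.subtype)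
    (Finsupp.mapRange_injective _ rfl L.injective_subtype)

theorem prodM_le_iff {K L P : Submodule R M} :
    prodM R M K L ≤ P ↔
      ∀ f : M →ₗ[R] M, LinearMap.range f ≤ L → ∀ x ∈ K, f x ∈ P := by
  simp only [prodM, iSup_le_iff, Submodule.map_le_iff_le_comap]
  rfl

theorem apply_mem_prodM {K L : Submodule R M} {f : M →ₗ[R] M} (hf : LinearMap.range f ≤ L)
    {x : M} (hx : x ∈ K) : f x ∈ prodM R M K L :=
  prodM_le_iff.1 le_rfl f hf x hx

theorem prodM_mono_right (K : Submodule R M) {L L' : Submodule R M} (h : L ≤ L') :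
    prodM R M K L ≤ prodM R M K L' :=
  prodM_le_iff.2 fun _ hf _ hx => apply_mem_prodM (hf.trans h) hx

theorem prodM_bot_left (L : Submodule R M) : prodM R M ⊥ L = ⊥ :=
  eq_bot_iff.2 <| prodM_le_iff.2 fun f _ x hx => by
    rw [(Submodule.mem_bot R).1 hx, map_zero]
    exact zero_mem _

theorem prodM_bot_right (K : Submodule R M) : prodM R M K ⊥ = ⊥ :=
  eq_bot_iff.2 <| prodM_le_iff.2 fun f hf x _ => hf (LinearMap.mem_range_self f x)

theorem prodM_prodM_le (K A X : Submodule R M) :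
    prodM R M (prodM R M K A) X ≤ prodM R M K (prodM R M A X) := by
  rw [prodM_le_iff]
  intro g hg y hy
  have h : prodM R M K A ≤ (prodM R M K (prodM R M A X)).comap g :=
    prodM_le_iff.2 fun f hf x hx => by
      refine apply_mem_prodM (f := g ∘ₗ f) ?_ hx
      rintro _ ⟨z, rfl⟩
      exact apply_mem_prodM hg (hf (LinearMap.mem_range_self f z))
  exact h hy

theorem ProjInSigma.le_prodM_prodM (hproj : ProjInSigma R M) (K A X : Submodule R M) :
    prodM R M K (prodM R M A X) ≤ prodM R M (prodM R M K A) X := by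
  rw [prodM_le_iff]
  intro f hf x hx
  let ι := {g : M →ₗ[R] M // LinearMap.range g ≤ X}
  let p : (ι →₀ A) →ₗ[R] M := Finsupp.lsum ℕ fun g : ι => g.1 ∘ₗ A.subtype
  have hp : prodM R M A X ≤ LinearMap.range p := prodM_le_iff.2 fun g hg a ha =>
    ⟨Finsupp.single ⟨g, hg⟩ ⟨a, ha⟩, by simp [p]⟩
  obtain ⟨h, hh⟩ := hproj _ _ (inSigma_finsupp_submodule ι A)
    (inSigma_submodule (LinearMap.range p)) p.rangeRestrict p.surjective_rangeRestrict
    (f.codRestrict _ fun z => hp (hf (LinearMap.mem_range_self f z)))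
  have hfx : p (h x) = f x := congrArg Subtype.val (LinearMap.congr_fun hh x)
  rw [← hfx]
  refine Submodule.sum_mem _ fun g _ => apply_mem_prodM g.2 ?_
  refine apply_mem_prodM (f := A.subtype ∘ₗ Finsupp.lapply g ∘ₗ h) ?_ hx
  rintro _ ⟨z, rfl⟩
  exact (h z g).2

theorem IsSemiprime.prodM_eq_bot_symm (hsemi : IsSemiprime R M) (hproj : ProjInSigma R M)
    {K L : Submodule R M} (h : prodM R M K L = ⊥) : prodM R M L K = ⊥ := by
  apply hsemi
  have hle : prodM R M K (prodM R M L K) ≤ ⊥ := by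
    simpa only [h, prodM_bot_left] using hproj.le_prodM_prodM K L K
  rw [eq_bot_iff, ← prodM_bot_right L]
  exact (prodM_prodM_le L K _).trans (prodM_mono_right L hle)

theorem le_annM_iff {L N : Submodule R M} : L ≤ annM R M N ↔ prodM R M L N = ⊥ := by
  rw [eq_bot_iff, prodM_le_iff, annM, le_iInf_iff]
  constructor
  · intro h f hf x hx
    exact congrArg Subtype.val
      (h (f.codRestrict N fun z => hf (LinearMap.mem_range_self f z)) hx)
  · intro h f x hx
    refine Subtype.ext (h (N.subtype ∘ₗ f) ?_ x hx)
    rintro _ ⟨z, rfl⟩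
    exact (f z).2

end ProductOfSubmodules

/-- in a semiprime module, `Ann_M(N) = Ann_M^r(N)` for every
submodule `N`. -/
theorem stmt_8 (R : Type u) [Ring R] (M : Type v) [AddCommGroup M] [Module R M]
    (hproj : ProjInSigma R M) (hsemi : IsSemiprime R M) (N : Submodule R M) :
    annM R M ↥N = annMr R M N := by
  apply le_antisymm
  · exact le_sSup (hsemi.prodM_eq_bot_symm hproj (le_annM_iff.1 le_rfl))
  · exact sSup_le fun L hL => le_annM_iff.2 (hsemi.prodM_eq_bot_symm hproj hL)
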